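/- Let n ≥ 1, let Ω = I_n ⊗ [[0,1],[-1,0]], let S be a real symplectic 2n×2n matrix, let ν₁,…,ν_n be reals with each ν_j > 1, let D := diag(ν₁,…,ν_n) ⊗ I₂, E := diag(√(1-ν₁⁻²),…,√(1-ν_n⁻²)) ⊗ I₂, V := SᵀDS and R := Sᵀ E S⁻ᵀ. Then, viewing all matrices as complex 2n×2n matrices, V − iΩ = R V (V + iΩ)⁻¹ V Rᵀ. -/

import Mathlib

open Matrix
open scoped Kronecker

noncomputable section

/-- The `2n × 2n` standard symplectic form `Ω = I_n ⊗ [[0,1],[-1,0]]`. -/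
def Omega (n : ℕ) : Matrix (Fin n × Fin 2) (Fin n × Fin 2) ℝ :=
  (1 : Matrix (Fin n) (Fin n) ℝ) ⊗ₖ !![(0 : ℝ), 1; -1, 0]

/-- Complexification of a real `2n × 2n` matrix. -/
def cmat {n : ℕ} (M : Matrix (Fin n × Fin 2) (Fin n × Fin 2) ℝ) :
    Matrix (Fin n × Fin 2) (Fin n × Fin 2) ℂ :=
  M.map Complex.ofReal

lemma Omega_mul_self (n : ℕ) : Omega n * Omega n = -1 := by
  have h : (!![(0 : ℝ), 1; -1, 0] * !![(0 : ℝ), 1; -1, 0]) = -1 := by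
    ext i j; fin_cases i <;> fin_cases j <;> simp [Matrix.mul_apply]
  rw [Omega, ← mul_kronecker_mul, h, one_mul, ← neg_one_smul ℝ (1 : Matrix (Fin 2) (Fin 2) ℝ),
    kronecker_smul, one_kronecker_one, neg_one_smul]

lemma commute_diagonal_kronecker_Omega {n : ℕ} (a : Fin n → ℝ) :
    Commute (diagonal a ⊗ₖ (1 : Matrix (Fin 2) (Fin 2) ℝ)) (Omega n) := by
  rw [Commute, SemiconjBy, Omega, ← mul_kronecker_mul, ← mul_kronecker_mul]
  simp

lemma cmat_mul {n : ℕ} (M N : Matrix (Fin n × Fin 2) (Fin n × Fin 2) ℝ) :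
    cmat (M * N) = cmat M * cmat N :=
  Matrix.map_mul (f := Complex.ofRealHom)

lemma cmat_one {n : ℕ} : cmat (1 : Matrix (Fin n × Fin 2) (Fin n × Fin 2) ℝ) = 1 :=
  Matrix.map_one Complex.ofReal Complex.ofReal_zero Complex.ofReal_one

lemma cmat_sub {n : ℕ} (M N : Matrix (Fin n × Fin 2) (Fin n × Fin 2) ℝ) :
    cmat (M - N) = cmat M - cmat N :=
  Matrix.map_sub Complex.ofReal Complex.ofReal_sub M N

lemma cmat_neg {n : ℕ} (M : Matrix (Fin n × Fin 2) (Fin n × Fin 2) ℝ) :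
    cmat (-M) = -cmat M := by
  ext i j; simp [cmat]

/-- A symplectic matrix is invertible. -/
lemma isUnit_det_of_symplectic {n : ℕ} {S : Matrix (Fin n × Fin 2) (Fin n × Fin 2) ℝ}
    (hS : Sᵀ * Omega n * S = Omega n) : IsUnit S.det := by
  refine isUnit_det_of_left_inverse (B := -(Omega n * (Sᵀ * Omega n))) ?_
  rw [neg_mul, mul_assoc, hS, Omega_mul_self, neg_neg]

/-- If `P` commutes with `Y` and `Y * X = P * P` is invertible, then `P * Y⁻¹ * P = X`; this is
the same identity after the congruence by an invertible `S`. -/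
lemma congr_mul_inv_mul_congr {m K : Type*} [Fintype m] [DecidableEq m] [Field K]
    {S T P X Y Q : Matrix m m K} (hS : IsUnit S.det) (hT : IsUnit T.det)
    (hPY : Commute P Y) (hYX : Y * X = P * P) (hQ : P * P * Q = 1) :
    T * P * S * (T * Y * S)⁻¹ * (T * P * S) = T * X * S := by
  have hY : IsUnit Y.det :=
    isUnit_det_of_right_inverse (B := X * Q) (by rw [← mul_assoc, hYX, hQ])
  have key : P * Y⁻¹ * P = X := by
    have h : Y * (P * Y⁻¹ * P) = Y * X := by
      rw [hYX, ← mul_assoc, ← mul_assoc, ← hPY.eq, mul_assoc P, mul_nonsing_inv _ hY, mul_one]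
    simpa [← mul_assoc, nonsing_inv_mul _ hY] using congrArg (Y⁻¹ * ·) h
  calc T * P * S * (T * Y * S)⁻¹ * (T * P * S)
      = T * P * (S * S⁻¹) * Y⁻¹ * (T⁻¹ * T) * P * S := by
        simp only [Matrix.mul_inv_rev, mul_assoc]
    _ = T * (P * Y⁻¹ * P) * S := by
        rw [mul_nonsing_inv _ hS, nonsing_inv_mul _ hT]; simp only [mul_one, mul_assoc]
    _ = T * X * S := by rw [key]

/-- With `V = SᵀDS` in Williamson form and `R = √(I + (VΩ)⁻²)`, one has
`V − iΩ = R V (V + iΩ)⁻¹ V Rᵀ` as complex matrices. -/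
theorem V_sub_iOmega_eq (n : ℕ) (hn : 1 ≤ n)
    (S : Matrix (Fin n × Fin 2) (Fin n × Fin 2) ℝ)
    (hS : Sᵀ * Omega n * S = Omega n)
    (ν : Fin n → ℝ) (hν : ∀ j, 1 < ν j)
    (D E V R : Matrix (Fin n × Fin 2) (Fin n × Fin 2) ℝ)
    (hD : D = (Matrix.diagonal ν) ⊗ₖ (1 : Matrix (Fin 2) (Fin 2) ℝ))
    (hE : E = (Matrix.diagonal fun j => Real.sqrt (1 - ((ν j) ^ 2)⁻¹)) ⊗ₖ
      (1 : Matrix (Fin 2) (Fin 2) ℝ))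
    (hV : V = Sᵀ * D * S)
    (hR : R = Sᵀ * E * (S⁻¹)ᵀ) :
    cmat V - Complex.I • cmat (Omega n) =
      cmat R * cmat V * (cmat V + Complex.I • cmat (Omega n))⁻¹ * cmat V * (cmat R)ᵀ := by
  have hdet := isUnit_det_of_symplectic hS
  have hdetT : IsUnit Sᵀ.det := by rwa [det_transpose]
  have hdetC : IsUnit (cmat S).det :=
    isUnit_det_of_right_inverse (B := cmat S⁻¹)
      (by rw [← cmat_mul, mul_nonsing_inv _ hdet, cmat_one])
  have hdetTC : IsUnit (cmat Sᵀ).det :=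
    isUnit_det_of_right_inverse (B := cmat Sᵀ⁻¹)
      (by rw [← cmat_mul, mul_nonsing_inv _ hdetT, cmat_one])
  have hDΩ : Commute D (Omega n) := hD ▸ commute_diagonal_kronecker_Omega ν
  have hEΩ : Commute E (Omega n) := hE ▸ commute_diagonal_kronecker_Omega _
  have hED : Commute E D := by
    rw [Commute, SemiconjBy, hD, hE, ← mul_kronecker_mul, ← mul_kronecker_mul,
      diagonal_mul_diagonal, diagonal_mul_diagonal]
    simp only [mul_comm]
  have hsq (j : Fin n) : 0 < ν j ^ 2 - 1 := by nlinarith [hν j]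
  have hP : E * D * (E * D) =
      (diagonal fun j => ν j ^ 2 - 1) ⊗ₖ (1 : Matrix (Fin 2) (Fin 2) ℝ) := by
    simp only [hD, hE, ← mul_kronecker_mul, diagonal_mul_diagonal, mul_one]
    congr 2
    ext j
    have hj : 0 < ν j := one_pos.trans (hν j)
    have h0 : 0 ≤ 1 - (ν j ^ 2)⁻¹ := by
      have := inv_le_one_of_one_le₀ (a := ν j ^ 2) (by linarith [hsq j])
      linarith
    rw [mul_mul_mul_comm, Real.mul_self_sqrt h0]
    field_simp
  have hDD : D * D - 1 = E * D * (E * D) := by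
    rw [sub_eq_iff_eq_add, hP, hD, ← mul_kronecker_mul, diagonal_mul_diagonal, mul_one,
      ← one_kronecker_one, ← add_kronecker, ← diagonal_one (n := Fin n), diagonal_add]
    simp only [pow_two, sub_add_cancel]
  have hQ : E * D * (E * D) *
      ((diagonal fun j => (ν j ^ 2 - 1)⁻¹) ⊗ₖ (1 : Matrix (Fin 2) (Fin 2) ℝ)) = 1 := by
    rw [hP, ← mul_kronecker_mul, diagonal_mul_diagonal, mul_one]
    simp only [mul_inv_cancel₀ (hsq _).ne', diagonal_one, one_kronecker_one]
  have hRV : R * V = Sᵀ * (E * D) * S := by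
    rw [hR, hV, transpose_nonsing_inv]
    calc Sᵀ * E * Sᵀ⁻¹ * (Sᵀ * D * S) = Sᵀ * E * (Sᵀ⁻¹ * Sᵀ) * D * S := by
          simp only [mul_assoc]
      _ = Sᵀ * (E * D) * S := by rw [nonsing_inv_mul _ hdetT]; simp only [mul_one, mul_assoc]
  have hVR : V * Rᵀ = Sᵀ * (E * D) * S := by
    have hDt : Dᵀ = D := by rw [hD, ← kroneckerMap_transpose]; simp
    have hEt : Eᵀ = E := by rw [hE, ← kroneckerMap_transpose]; simp
    have hVt : Vᵀ = V := by simp [hV, hDt, mul_assoc]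
    rw [← transpose_transpose (V * Rᵀ), transpose_mul, transpose_transpose, hVt, hRV]
    simp only [transpose_mul, transpose_transpose, hDt, hEt, hED.eq, mul_assoc]
  have hRt : (cmat R)ᵀ = cmat Rᵀ := rfl
  have hsub : cmat V - Complex.I • cmat (Omega n) =
      cmat Sᵀ * (cmat D - Complex.I • cmat (Omega n)) * cmat S := by
    conv_lhs => rw [← hS, hV]
    simp only [cmat_mul, mul_sub, sub_mul, mul_smul_comm, smul_mul_assoc]
  have hadd : cmat V + Complex.I • cmat (Omega n) =
      cmat Sᵀ * (cmat D + Complex.I • cmat (Omega n)) * cmat S := by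
    conv_lhs => rw [← hS, hV]
    simp only [cmat_mul, mul_add, add_mul, mul_smul_comm, smul_mul_assoc]
  have hcomm {A B : Matrix (Fin n × Fin 2) (Fin n × Fin 2) ℝ} (h : Commute A B) :
      Commute (cmat A) (cmat B) := by
    rw [Commute, SemiconjBy, ← cmat_mul, ← cmat_mul, h.eq]
  have hYX : (cmat D + Complex.I • cmat (Omega n)) * (cmat D - Complex.I • cmat (Omega n)) =
      cmat (E * D) * cmat (E * D) := by
    rw [← ((hcomm hDΩ).smul_right Complex.I).mul_self_sub_mul_self_eq, ← cmat_mul, ← cmat_mul, ← hDD,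
      smul_mul_smul_comm, ← cmat_mul, Omega_mul_self, cmat_sub, cmat_neg]
    simp [Complex.I_mul_I]
  have hPY : Commute (cmat (E * D)) (cmat D + Complex.I • cmat (Omega n)) :=
    (hcomm (hED.mul_left (Commute.refl D))).add_right
      ((hcomm (hEΩ.mul_left hDΩ)).smul_right Complex.I)
  rw [mul_assoc _ (cmat V) (cmat R)ᵀ, hRt, ← cmat_mul, ← cmat_mul, hRV, hVR, hsub, hadd]
  simp only [cmat_mul _ S, cmat_mul Sᵀ]
  exact (congr_mul_inv_mul_congr hdetC hdetTC hPY hYX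
    (by rw [← cmat_mul, ← cmat_mul, hQ, cmat_one])).symm

end
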